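/- In the universal (non-periodic) infinite frieze, for all i \ge 3 and j \in \mathbb{Z}, the polynomial a_{i,j} - a_{i-2,j+1} equals the sum, over all sets M of pairwise disjoint edges of the cycle on the vertex set \{j, j+1, \ldots, j+i-1\} (the edges being the pairs {j+k, j+k+1} for 0 \le k \le i-2 together with the pair {j+i-1, j}), of (-1)^{|M|} times the product of the variables z_k over all vertices k not covered by any edge in M. In other words, a_{i,j} - a_{i-2,j+1} is the sum of the monomial z_j z_{j+1} \cdots z_{j+i-1} and of all monomials obtained from it by replacing disjoint pairs of cyclically consecutive z_k's (allowing also the pair formed by z_{j+i-1} and z_j) by -1. -/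

import Mathlib

open MvPolynomial

/-- The `i × i` tridiagonal matrix with diagonal entries `z_j, z_{j+1}, …, z_{j+i-1}`
and all sub- and super-diagonal entries equal to `1`, over `ℤ[z_j : j ∈ ℤ]`. -/
noncomputable def friezeMatrix (i : ℕ) (j : ℤ) :
    Matrix (Fin i) (Fin i) (MvPolynomial ℤ ℤ) :=
  Matrix.of fun k l =>
    if (k : ℕ) = (l : ℕ) then X (j + (k : ℕ))
    else if (k : ℕ) + 1 = (l : ℕ) ∨ (l : ℕ) + 1 = (k : ℕ) then 1 else 0

/-- The universal infinite frieze: `a i j` is the determinant of the `i × i`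
tridiagonal matrix above. -/
noncomputable def univA (i : ℕ) (j : ℤ) : MvPolynomial ℤ ℤ :=
  (friezeMatrix i j).det

theorem friezeMatrix_submatrix_succ (n : ℕ) (j : ℤ) :
    (friezeMatrix (n + 1) j).submatrix Fin.succ Fin.succ = friezeMatrix n (j + 1) := by
  ext1 k l
  simp only [friezeMatrix, Matrix.submatrix_apply, Matrix.of_apply, Fin.val_succ,
    Nat.add_right_cancel_iff]
  push_cast
  rw [add_assoc j 1, add_comm (1 : ℤ)]

theorem univA_zero (j : ℤ) : univA 0 j = 1 := by
  simp [univA]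

theorem univA_one (j : ℤ) : univA 1 j = X j := by
  simp [univA, friezeMatrix]

theorem univA_add_two (n : ℕ) (j : ℤ) :
    univA (n + 2) j = X j * univA (n + 1) (j + 1) - univA n (j + 2) := by
  have hminor : ((friezeMatrix (n + 2) j).submatrix Fin.succ
      (Fin.succAbove (Fin.succ 0))).det = univA n (j + 2) := by
    have hsub : ((friezeMatrix (n + 2) j).submatrix Fin.succ
        (Fin.succAbove (Fin.succ 0))).submatrix Fin.succ Fin.succ =
          friezeMatrix n (j + 2) := by
      rw [show j + 2 = j + 1 + 1 by ring, ← friezeMatrix_submatrix_succ,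
        ← friezeMatrix_submatrix_succ]
      ext1 k l
      simp [Matrix.submatrix_apply]
    rw [Matrix.det_succ_column_zero, Fin.sum_univ_succ, Finset.sum_eq_zero]
    · rw [Fin.succAbove_zero, hsub]
      simp [friezeMatrix, univA]
    · intro k _
      simp [friezeMatrix]
  have hfirst : ((friezeMatrix (n + 2) j).submatrix Fin.succ (Fin.succAbove 0)).det =
      univA (n + 1) (j + 1) := by
    rw [Fin.succAbove_zero, friezeMatrix_submatrix_succ, univA]
  rw [univA, Matrix.det_succ_row_zero, Fin.sum_univ_succ, Fin.sum_univ_succ, hfirst, hminor,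
    Finset.sum_eq_zero]
  · simp [friezeMatrix]
    ring
  · intro k _
    simp [friezeMatrix]

/-- The signed sum over the matchings of the path on the vertices `a, …, a + n - 1`, an edge
`{k, k + 1}` being encoded by `k`, of the products of the weights of the uncovered vertices. -/
def pathMatchingSum {R : Type*} [CommRing R] (x : ℕ → R) (a n : ℕ) : R :=
  ∑ S ∈ (Finset.Ico a (a + n - 1)).powerset.filter (fun S => ∀ k ∈ S, k + 1 ∉ S),
    (-1) ^ S.card *
      ∏ m ∈ (Finset.Ico a (a + n)).filter (fun m => m ∉ S ∧ ∀ k ∈ S, k + 1 ≠ m), x m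

section PathMatchingSum

variable {R : Type*} [CommRing R] (x : ℕ → R)

theorem pathMatchingSum_zero (a : ℕ) : pathMatchingSum x a 0 = 1 := by
  simp [pathMatchingSum, Finset.filter_singleton]

theorem pathMatchingSum_one (a : ℕ) : pathMatchingSum x a 1 = x a := by
  simp [pathMatchingSum, Finset.filter_singleton]

theorem pathMatchingSum_add_two (a n : ℕ) :
    pathMatchingSum x a (n + 2) =
      x a * pathMatchingSum x (a + 1) (n + 1) - pathMatchingSum x (a + 2) n := by
  rw [pathMatchingSum, ← Finset.sum_filter_not_add_sum_filter _ (fun S => a ∈ S), sub_eq_add_neg]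
  congr 1
  · rw [pathMatchingSum, Finset.mul_sum]
    refine Finset.sum_congr ?_ ?_
    · ext S
      simp only [Finset.mem_filter, Finset.mem_powerset, Finset.subset_iff, Finset.mem_Ico]
      grind
    · intro S hS
      simp only [Finset.mem_filter, Finset.mem_powerset, Finset.subset_iff, Finset.mem_Ico] at hS
      rw [mul_left_comm, ← Finset.prod_insert (by simp)]
      congr 2
      ext m
      simp only [Finset.mem_filter, Finset.mem_insert, Finset.mem_Ico]
      grind
  · rw [pathMatchingSum, ← Finset.sum_neg_distrib]
    refine Finset.sum_nbij' (fun S => S.erase a) (fun T => insert a T) ?_ ?_ ?_ ?_ ?_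
    · intro S hS
      simp only [Finset.mem_filter, Finset.mem_powerset, Finset.subset_iff, Finset.mem_Ico,
        Finset.mem_erase] at hS ⊢
      grind
    · intro T hT
      simp only [Finset.mem_filter, Finset.mem_powerset, Finset.subset_iff, Finset.mem_Ico,
        Finset.mem_insert] at hT ⊢
      grind
    · intro S hS
      exact Finset.insert_erase (Finset.mem_filter.mp hS).2
    · intro T hT
      simp only [Finset.mem_filter, Finset.mem_powerset, Finset.subset_iff, Finset.mem_Ico] at hT
      exact Finset.erase_insert (by grind)
    · intro S hS
      simp only [Finset.mem_filter, Finset.mem_powerset, Finset.subset_iff, Finset.mem_Ico] at hS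
      rw [← Finset.card_erase_add_one hS.2, pow_succ, mul_neg_one, neg_mul]
      congr 3
      ext m
      simp only [Finset.mem_filter, Finset.mem_Ico, Finset.mem_erase]
      grind

theorem sum_cycleMatchings_filter_notMem {i : ℕ} (hi : 3 ≤ i) {f : ℕ → ℕ}
    (hf : ∀ k, k < i → k + 1 < i ∧ f k = k + 1 ∨ k + 1 = i ∧ f k = 0) :
    ∑ S ∈ ((Finset.range i).powerset.filter (fun S => ∀ k ∈ S, f k ∉ S)).filter
        (fun S => i - 1 ∉ S),
      (-1) ^ S.card *
        ∏ m ∈ (Finset.range i).filter (fun m => m ∉ S ∧ ∀ k ∈ S, f k ≠ m), x m =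
      pathMatchingSum x 0 i := by
  rw [pathMatchingSum, zero_add]
  refine Finset.sum_congr ?_ ?_
  · ext S
    simp only [Finset.mem_filter, Finset.mem_powerset, Finset.subset_iff, Finset.mem_Ico,
      Finset.mem_range]
    grind
  · intro S hS
    simp only [Finset.mem_filter, Finset.mem_powerset, Finset.subset_iff, Finset.mem_Ico] at hS
    congr 2
    ext m
    simp only [Finset.mem_filter, Finset.mem_Ico, Finset.mem_range]
    grind

theorem sum_cycleMatchings_filter_mem {i : ℕ} (hi : 3 ≤ i) {f : ℕ → ℕ}
    (hf : ∀ k, k < i → k + 1 < i ∧ f k = k + 1 ∨ k + 1 = i ∧ f k = 0) :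
    ∑ S ∈ ((Finset.range i).powerset.filter (fun S => ∀ k ∈ S, f k ∉ S)).filter
        (fun S => i - 1 ∈ S),
      (-1) ^ S.card *
        ∏ m ∈ (Finset.range i).filter (fun m => m ∉ S ∧ ∀ k ∈ S, f k ≠ m), x m =
      -pathMatchingSum x 1 (i - 2) := by
  obtain ⟨n, rfl⟩ := Nat.exists_eq_add_of_le' hi
  rw [show n + 3 - 1 = n + 2 by omega, show n + 3 - 2 = n + 1 by omega]
  have hlast : f (n + 2) = 0 := by grind
  have hstep : ∀ k, k < n + 2 → f k = k + 1 := by grind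
  clear hf
  rw [pathMatchingSum, ← Finset.sum_neg_distrib]
  refine Finset.sum_nbij' (fun S => S.erase (n + 2)) (fun T => insert (n + 2) T) ?_ ?_ ?_ ?_ ?_
  · intro S hS
    simp only [Finset.mem_filter, Finset.mem_powerset, Finset.subset_iff, Finset.mem_Ico,
      Finset.mem_range, Finset.mem_erase] at hS ⊢
    grind
  · intro T hT
    simp only [Finset.mem_filter, Finset.mem_powerset, Finset.subset_iff, Finset.mem_Ico,
      Finset.mem_range, Finset.mem_insert] at hT ⊢
    grind
  · intro S hS
    exact Finset.insert_erase (Finset.mem_filter.mp hS).2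
  · intro T hT
    simp only [Finset.mem_filter, Finset.mem_powerset, Finset.subset_iff, Finset.mem_Ico] at hT
    exact Finset.erase_insert (by grind)
  · intro S hS
    simp only [Finset.mem_filter, Finset.mem_powerset, Finset.subset_iff, Finset.mem_range] at hS
    rw [← Finset.card_erase_add_one hS.2, pow_succ, mul_neg_one, neg_mul]
    congr 3
    ext m
    simp only [Finset.mem_filter, Finset.mem_Ico, Finset.mem_range, Finset.mem_erase]
    grind

end PathMatchingSum

theorem univA_eq_pathMatchingSum (j : ℤ) (n a : ℕ) :
    univA n (j + a) = pathMatchingSum (fun m : ℕ => X (j + (m : ℤ))) a n := by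
  induction n using Nat.twoStepInduction generalizing a with
  | zero => rw [univA_zero, pathMatchingSum_zero]
  | one => rw [univA_one, pathMatchingSum_one]
  | more n ih₀ ih₁ =>
    rw [univA_add_two, pathMatchingSum_add_two, ← ih₀, ← ih₁]
    push_cast
    simp only [add_assoc]

/-- For `i ≥ 3`, the polynomial `a i j - a (i-2) (j+1)` equals the
sum over all matchings of the cycle on the vertices `{j, j+1, …, j+i-1}`.  We encode
an edge of the cycle by `k ∈ {0, …, i-1}`, standing for the pair
`{j+k, j+((k+1) mod i)}`; a matching is a set `S` of edges no two of which share a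
vertex, i.e. `∀ k ∈ S, (k+1) % i ∉ S`; its term is `(-1)^|S|` times the product of
the variables `z_{j+m}` over the vertices `j+m` not covered by any edge of `S`. -/
theorem universal_frieze_cyclic_formula :
    ∀ i : ℕ, 3 ≤ i → ∀ j : ℤ,
      univA i j - univA (i - 2) (j + 1) =
        ∑ S ∈ (Finset.range i).powerset.filter (fun S => ∀ k ∈ S, (k + 1) % i ∉ S),
          (-1 : MvPolynomial ℤ ℤ) ^ S.card *
            ∏ m ∈ (Finset.range i).filter (fun m => m ∉ S ∧ ∀ k ∈ S, (k + 1) % i ≠ m),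
              X (j + (m : ℤ)) := by
  intro i hi j
  have hpath : univA i j = pathMatchingSum (fun m : ℕ => X (j + (m : ℤ))) 0 i := by
    simpa using univA_eq_pathMatchingSum j i 0
  have hinner : univA (i - 2) (j + 1) =
      pathMatchingSum (fun m : ℕ => X (j + (m : ℤ))) 1 (i - 2) := by
    simpa using univA_eq_pathMatchingSum j (i - 2) 1
  have hmod : ∀ k, k < i → k + 1 < i ∧ (k + 1) % i = k + 1 ∨ k + 1 = i ∧ (k + 1) % i = 0 := by
    intro k hk
    rcases Nat.lt_or_eq_of_le (Nat.succ_le_of_lt hk) with h | h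
    · exact Or.inl ⟨h, Nat.mod_eq_of_lt h⟩
    · exact Or.inr ⟨h, by rw [← h, Nat.mod_self]⟩
  rw [← Finset.sum_filter_not_add_sum_filter _ (fun S => i - 1 ∈ S),
    sum_cycleMatchings_filter_notMem _ hi hmod, sum_cycleMatchings_filter_mem _ hi hmod, hpath,
    hinner, sub_eq_add_neg]
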